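/- Let A ⊆ ℕ have positive lower density and set ψ(q) = 1/(q·log q·log log q·log log log q) (with log x := 1 for x ≤ e). Then for Haar-almost every α ∈ 𝕋 there exist a constant C = C(α) > 0 and infinitely many even indices k such that q_k(α) ∈ A, 0 ≤ α − p_k/q_k < ψ(q_k)/q_k, and a_{k+1}(α) ≥ C·k·log k·log log k. -/

import Mathlib

open MeasureTheory Filter Set Topology

noncomputable def toCircle (x : ℝ) : UnitAddCircle := x

/-- The canonical embedding `ι : 𝕋 → [0,1) ⊆ ℝ`. -/
noncomputable def iota (x : UnitAddCircle) : ℝ := (AddCircle.equivIco 1 0 x : ℝ)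

/-- The Birkhoff sum `S_N(f, α, x₀) = ∑_{k=0}^{N-1} f(x₀ + kα)`. -/
noncomputable def birkhoff (f : UnitAddCircle → ℝ) (α x₀ : UnitAddCircle) (N : ℕ) : ℝ :=
  ∑ k ∈ Finset.range N, f (x₀ + k • α)

/-- Iterates of the Gauss map, starting from the fractional part of `α`. -/
noncomputable def gaussIter (α : ℝ) : ℕ → ℝ
  | 0 => Int.fract α
  | n + 1 => Int.fract (1 / gaussIter α n)

/-- The `k`-th partial quotient `a_k(α)` (for `k ≥ 1`) of the continued fraction
expansion of `α`. -/
noncomputable def cfA (α : ℝ) (k : ℕ) : ℕ := ⌊1 / gaussIter α (k - 1)⌋₊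

/-- The denominators `q_k(α)` of the convergents of `α`:
`q₀ = 1`, `q₁ = a₁`, `q_{k+1} = a_{k+1} q_k + q_{k-1}`. -/
noncomputable def cfQ (α : ℝ) : ℕ → ℕ
  | 0 => 1
  | 1 => cfA α 1
  | (k + 2) => cfA α (k + 2) * cfQ α (k + 1) + cfQ α k

/-- The numerators `p_k(α)` of the convergents of `α`:
`p₀ = 0`, `p₁ = 1`, `p_{k+1} = a_{k+1} p_k + p_{k-1}`. -/
noncomputable def cfP (α : ℝ) : ℕ → ℕ
  | 0 => 0
  | 1 => 1
  | (k + 2) => cfA α (k + 2) * cfP α (k + 1) + cfP α k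

open scoped Classical in
/-- The lower (asymptotic) density of a set `A ⊆ ℕ`:
`liminf_{N → ∞} #(A ∩ {1,…,N}) / N`. -/
noncomputable def lowerDensity (A : Set ℕ) : ℝ :=
  Filter.liminf (fun N : ℕ => (((Finset.Icc 1 N).filter (· ∈ A)).card : ℝ) / N) Filter.atTop

/-- `log x` with the convention `log x := 1` for `x ≤ e`. -/
noncomputable def mlog (x : ℝ) : ℝ := if x ≤ Real.exp 1 then 1 else Real.log x

/-- `ψ(q) = 1 / (q log q log log q log log log q)` with the convention above. -/
noncomputable def psiDS (q : ℕ) : ℝ :=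
  1 / (q * mlog q * mlog (mlog q) * mlog (mlog (mlog q)))

lemma mlog_eq_log_max (x : ℝ) : mlog x = Real.log (max x (Real.exp 1)) := by
  unfold mlog
  split_ifs with h
  · rw [max_eq_right h, Real.log_exp]
  · rw [max_eq_left (not_le.mp h).le]

lemma mlog_mono : Monotone mlog := fun x y h => by
  rw [mlog_eq_log_max, mlog_eq_log_max]
  exact Real.log_le_log (by positivity) (max_le_max_right _ h)

lemma one_le_mlog (x : ℝ) : 1 ≤ mlog x := by
  rw [mlog_eq_log_max, Real.le_log_iff_exp_le (by positivity)]
  exact le_max_right _ _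

lemma mlog_pos (x : ℝ) : 0 < mlog x := one_pos.trans_le (one_le_mlog x)

lemma log_le_mlog {x : ℝ} (hx : 0 < x) : Real.log x ≤ mlog x := by
  rw [mlog_eq_log_max]
  exact Real.log_le_log hx (le_max_left _ _)

lemma mlog_mul_le (a : ℝ) {b : ℝ} (hb : 1 ≤ b) : mlog (b * a) ≤ mlog a + Real.log b := by
  have hb0 : 0 < b := by linarith
  have he := Real.exp_pos 1
  rw [mlog_eq_log_max, mlog_eq_log_max, add_comm, ← Real.log_mul hb0.ne' (by positivity)]
  refine Real.log_le_log (by positivity) (max_le ?_ ?_)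
  · gcongr
    exact le_max_left _ _
  · calc Real.exp 1 ≤ max a (Real.exp 1) := le_max_right _ _
      _ ≤ b * max a (Real.exp 1) := le_mul_of_one_le_left (by positivity) hb

lemma mlog_mul_le_three_mul (a : ℝ) {b : ℝ} (hb : 1 ≤ b) (hb' : b ≤ 4) :
    mlog (b * a) ≤ 3 * mlog a := by
  have h1 := mlog_mul_le a hb
  have h2 : Real.log b ≤ 2 := by
    calc Real.log b ≤ Real.log 4 := Real.log_le_log (by linarith) hb'
      _ = 2 * Real.log 2 := by
        rw [show (4 : ℝ) = 2 ^ 2 by norm_num, Real.log_pow]; norm_num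
      _ ≤ 2 := by linarith [Real.log_two_lt_d9]
  linarith [one_le_mlog a]

lemma mlog_two_pow_le {n : ℕ} (hn : n ≠ 0) : mlog (2 ^ n) ≤ n := by
  have h1 : (1 : ℝ) ≤ n := by exact_mod_cast Nat.one_le_iff_ne_zero.mpr hn
  rw [mlog_eq_log_max, Real.log_le_iff_le_exp (by positivity)]
  refine max_le ?_ (Real.exp_le_exp.mpr h1)
  rw [← mul_one (n : ℝ), Real.exp_nat_mul]
  gcongr
  linarith [Real.exp_one_gt_d9]

lemma not_summable_mlog_step {L : ℝ → ℝ} (hL : Monotone L) (hL1 : ∀ x, 1 ≤ L x)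
    (h : ¬ Summable fun n : ℕ => 1 / ((n : ℝ) * L n)) :
    ¬ Summable fun n : ℕ => 1 / ((n : ℝ) * (mlog n * L (mlog n))) := by
  have hL0 : ∀ x, 0 < L x := fun x => one_pos.trans_le (hL1 x)
  rw [← summable_condensed_iff_of_nonneg]
  · refine fun hs => h (hs.of_nonneg_of_le (fun n => ?_) fun n => ?_)
    · have := hL0 n
      positivity
    · rcases eq_or_ne n 0 with rfl | hn
      · have := hL0 (mlog (2 ^ 0)); have := mlog_pos (2 ^ 0)
        simp only [Nat.cast_zero, zero_mul, div_zero]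
        push_cast
        positivity
      · have h1 := mlog_two_pow_le hn
        have h2 := hL h1
        have h3 := hL0 (mlog (2 ^ n))
        have h4 := mlog_pos (2 ^ n)
        push_cast
        rw [mul_one_div, div_mul_eq_div_div (2 ^ n), div_self (by positivity)]
        gcongr
  · intro n
    have := hL0 (mlog n); have := mlog_pos n
    positivity
  · intro m n hm hmn
    have h1 : (m : ℝ) ≤ n := by exact_mod_cast hmn
    have h2 := mlog_mono h1
    have := hL h2
    have := hL0 (mlog m); have := mlog_pos m
    have : (0 : ℝ) < m := by exact_mod_cast hm
    have := mlog_pos n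
    gcongr

lemma not_summable_psiDS : ¬ Summable psiDS := by
  have h0 : ¬ Summable fun n : ℕ => 1 / ((n : ℝ) * 1) := by
    simpa using Real.not_summable_natCast_inv
  have h1 := not_summable_mlog_step (L := fun _ => 1) monotone_const (fun _ => le_rfl) h0
  simp only [mul_one] at h1
  have h2 := not_summable_mlog_step mlog_mono one_le_mlog h1
  have h3 := not_summable_mlog_step (L := fun x => mlog x * mlog (mlog x))
    (mlog_mono.mul (mlog_mono.comp mlog_mono) (fun x => (mlog_pos x).le) fun x => (mlog_pos _).le)
    (fun x => one_le_mul_of_one_le_of_one_le (one_le_mlog _) (one_le_mlog _)) h2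
  refine fun h => h3 (h.congr fun n => ?_)
  simp only [psiDS, mul_assoc]

lemma psiDS_nonneg (q : ℕ) : 0 ≤ psiDS q := by
  have := mlog_pos q; have := mlog_pos (mlog q); have := mlog_pos (mlog (mlog q))
  unfold psiDS
  positivity

lemma psiDS_anti {m n : ℕ} (hm : 0 < m) (hmn : m ≤ n) : psiDS n ≤ psiDS m := by
  have h1 : (m : ℝ) ≤ n := by exact_mod_cast hmn
  have h2 := mlog_mono h1
  have h3 := mlog_mono h2
  have h4 := mlog_mono h3
  have := mlog_pos m; have := mlog_pos (mlog m); have := mlog_pos (mlog (mlog m))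
  have := mlog_pos n; have := mlog_pos (mlog n)
  have : (0 : ℝ) < m := by exact_mod_cast hm
  unfold psiDS
  gcongr

lemma psiDS_le (q : ℕ) : psiDS q ≤ 1 / q := by
  rcases Nat.eq_zero_or_pos q with rfl | hq
  · simp [psiDS]
  have h0 : (0 : ℝ) < q := by exact_mod_cast hq
  unfold psiDS
  gcongr
  have h1 := one_le_mul_of_one_le_of_one_le (one_le_mlog q) (one_le_mlog (mlog q))
  have h2 := one_le_mul_of_one_le_of_one_le h1 (one_le_mlog (mlog (mlog q)))
  calc (q : ℝ) = q * 1 := (mul_one _).symm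
    _ ≤ q * (mlog q * mlog (mlog q) * mlog (mlog (mlog q))) := by gcongr
    _ = _ := by ring

section Density

open scoped Classical in
/-- A non-summable monotone weight stays non-summable on a set whose counting function
grows at least linearly. -/
lemma not_summable_indicator_of_count {f : ℕ → ℝ} (hf0 : ∀ n, 0 ≤ f n)
    (hfm : ∀ ⦃m n⦄, 0 < m → m ≤ n → f n ≤ f m) (hf : ¬ Summable f) {B : Set ℕ} {ρ : ℝ}
    (hρ : 0 < ρ) {K : ℝ}
    (hB : ∀ N : ℕ, ρ * N - K ≤ (((Finset.Icc 1 N).filter (· ∈ B)).card : ℝ)) :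
    ¬ Summable (B.indicator f) := by
  intro hs
  have key : ∀ N : ℕ, 1 ≤ N →
      ((((Finset.Icc 1 N).filter (· ∈ B)).card : ℝ) - ρ * N + K) * f N - K * f 1
        ≤ ∑ n ∈ Finset.Icc 1 N, (B.indicator f n - ρ * f n) := by
    intro N hN
    induction N, hN using Nat.le_induction with
    | base =>
      by_cases h : (1 : ℕ) ∈ B
      · simp [h, Finset.filter_singleton]; linarith
      · simp [h, Finset.filter_singleton]; linarith
    | succ N hN ih =>
      rw [Finset.sum_Icc_succ_top (by omega)]
      have hcard : (((Finset.Icc 1 (N + 1)).filter (· ∈ B)).card : ℝ)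
          = ((Finset.Icc 1 N).filter (· ∈ B)).card + (if N + 1 ∈ B then 1 else 0) := by
        rw [← Finset.insert_Icc_right_eq_Icc_add_one (by omega), Finset.filter_insert]
        split_ifs with h
        · rw [Finset.card_insert_of_notMem (by simp)]; push_cast; rfl
        · simp
      have hind : B.indicator f (N + 1) = (if N + 1 ∈ B then 1 else 0) * f (N + 1) := by
        by_cases h : N + 1 ∈ B <;> simp [h]
      rw [hcard, hind]
      have h1 := hfm (by omega : 0 < N) (Nat.le_succ N)
      have h2 := hB N
      push_cast
      nlinarith [mul_nonneg (sub_nonneg.mpr h1) (sub_nonneg.mpr h2)]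
  have hbound : ∀ N : ℕ, ∑ n ∈ Finset.Icc 1 N, f n ≤
      ρ⁻¹ * (∑' n, B.indicator f n + |K * f 1|) := by
    intro N
    rcases Nat.eq_zero_or_pos N with rfl | hN
    · have : 0 ≤ ∑' n, B.indicator f n := tsum_nonneg fun n => indicator_nonneg (fun n _ => hf0 n) n
      simp only [Finset.Icc_eq_empty (by norm_num : ¬ (1 ≤ 0)), Finset.sum_empty]
      positivity
    have h1 := key N hN
    have h2 : 0 ≤ ((((Finset.Icc 1 N).filter (· ∈ B)).card : ℝ) - ρ * N + K) * f N :=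
      mul_nonneg (by linarith [hB N]) (hf0 N)
    rw [Finset.sum_sub_distrib, ← Finset.mul_sum] at h1
    have h3 := hs.sum_le_tsum (Finset.Icc 1 N) fun n _ => indicator_nonneg (fun n _ => hf0 n) n
    rw [le_inv_mul_iff₀ hρ]
    linarith [le_abs_self (K * f 1)]
  apply hf
  refine summable_of_sum_range_le (c := f 0 + ρ⁻¹ * (∑' n, B.indicator f n + |K * f 1|)) hf0
    fun n => ?_
  calc ∑ i ∈ Finset.range n, f i ≤ ∑ i ∈ insert 0 (Finset.Icc 1 n), f i := by
        refine Finset.sum_le_sum_of_subset_of_nonneg (fun i hi => ?_) fun i _ _ => hf0 i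
        simp at hi ⊢; omega
    _ = f 0 + ∑ i ∈ Finset.Icc 1 n, f i := by rw [Finset.sum_insert (by simp)]
    _ ≤ _ := by linarith [hbound n]

lemma exp_neg_sum_primeFactors_mul_le_totient {n : ℕ} (hn : n ≠ 0) :
    Real.exp (-(2 * ∑ p ∈ n.primeFactors, (1 : ℝ) / (p : ℕ))) * n ≤ n.totient := by
  have h : (n.totient : ℝ) = n * ∏ p ∈ n.primeFactors, (1 - (p : ℝ)⁻¹) := by
    have := Nat.totient_eq_mul_prod_factors n
    simpa using congrArg (Rat.cast : ℚ → ℝ) this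
  rw [h, mul_comm]
  gcongr
  rw [Finset.mul_sum, ← Finset.sum_neg_distrib, Real.exp_sum]
  refine Finset.prod_le_prod (fun _ _ => (Real.exp_pos _).le) fun p hp => ?_
  have hp2 : (2 : ℝ) ≤ p := by exact_mod_cast (Nat.prime_of_mem_primeFactors hp).two_le
  have h1 : Real.exp (-(2 * (1 / p : ℝ))) * Real.exp (2 * (1 / p : ℝ)) = 1 := by
    rw [← Real.exp_add]; simp
  have h2 := Real.add_one_le_exp (2 * (1 / p : ℝ))
  have h3 : (1 : ℝ) ≤ (1 - (p : ℝ)⁻¹) * (2 * (1 / p : ℝ) + 1) := by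
    have : (p : ℝ)⁻¹ ≤ 2⁻¹ := by gcongr
    have h0 : 0 < (p : ℝ)⁻¹ := by positivity
    rw [one_div]
    nlinarith
  have h4 : 0 ≤ (1 - (p : ℝ)⁻¹) := by
    have : (p : ℝ)⁻¹ ≤ 2⁻¹ := by gcongr
    linarith
  have h5 : (1 : ℝ) ≤ (1 - (p : ℝ)⁻¹) * Real.exp (2 * (1 / p : ℝ)) :=
    h3.trans (mul_le_mul_of_nonneg_left h2 h4)
  exact le_of_mul_le_mul_right (h1.trans_le h5) (Real.exp_pos _)

lemma sum_sum_primeFactors_inv_le (N : ℕ) :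
    ∑ n ∈ Finset.Icc 1 N, ∑ p ∈ n.primeFactors, (1 : ℝ) / (p : ℕ) ≤ 2 * N := by
  have h1 : ∑ n ∈ Finset.Icc 1 N, ∑ p ∈ n.primeFactors, (1 : ℝ) / (p : ℕ)
      ≤ ∑ n ∈ Finset.Icc 1 N, ∑ p ∈ Finset.Icc 1 N, if p ∣ n then (1 : ℝ) / p else 0 := by
    refine Finset.sum_le_sum fun n hn => ?_
    rw [← Finset.sum_filter]
    refine Finset.sum_le_sum_of_subset_of_nonneg (fun p hp => ?_) fun _ _ _ => by positivity
    have hp1 := Nat.prime_of_mem_primeFactors hp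
    have hp2 := Nat.dvd_of_mem_primeFactors hp
    simp only [Finset.mem_Icc, Finset.mem_filter] at hn ⊢
    exact ⟨⟨hp1.one_le, (Nat.le_of_dvd (by omega) hp2).trans hn.2⟩, hp2⟩
  refine h1.trans ?_
  rw [Finset.sum_comm]
  have h2 : ∀ p ∈ Finset.Icc 1 N, (∑ n ∈ Finset.Icc 1 N, if p ∣ n then (1 : ℝ) / p else 0)
      ≤ N * ((p : ℝ) ^ 2)⁻¹ := by
    intro p hp
    rw [← Finset.sum_filter, Finset.sum_const, nsmul_eq_mul]
    have hc : ((Finset.Icc 1 N).filter (p ∣ ·)).card = N / p := by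
      have := Nat.Ioc_filter_dvd_card_eq_div N p
      rwa [← Finset.Icc_add_one_left_eq_Ioc] at this
    rw [hc]
    have h3 : ((N / p : ℕ) : ℝ) ≤ N / p := Nat.cast_div_le
    calc ((N / p : ℕ) : ℝ) * (1 / p) ≤ (N / p) * (1 / p) := by gcongr
      _ = _ := by ring
  refine (Finset.sum_le_sum h2).trans ?_
  rw [← Finset.mul_sum, mul_comm]
  gcongr
  have h4 := sum_Ioo_inv_sq_le (α := ℝ) 0 (N + 1)
  have h5 : Finset.Ioo 0 (N + 1) = Finset.Icc 1 N := by ext; simp; omega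
  simpa [h5] using h4

open scoped Classical in
lemma card_filter_lt_sum_primeFactors_inv_le (N : ℕ) {t : ℝ} (ht : 0 < t) :
    (((Finset.Icc 1 N).filter fun n => t < ∑ p ∈ n.primeFactors, (1 : ℝ) / (p : ℕ)).card : ℝ)
      ≤ 2 * N / t := by
  rw [le_div_iff₀ ht, ← nsmul_eq_mul]
  calc _ ≤ ∑ n ∈ (Finset.Icc 1 N).filter fun n => t < ∑ p ∈ n.primeFactors, (1 : ℝ) / (p : ℕ),
        ∑ p ∈ n.primeFactors, (1 : ℝ) / (p : ℕ) :=
        Finset.card_nsmul_le_sum _ _ _ fun n hn => (Finset.mem_filter.mp hn).2.le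
    _ ≤ ∑ n ∈ Finset.Icc 1 N, ∑ p ∈ n.primeFactors, (1 : ℝ) / (p : ℕ) :=
        Finset.sum_le_sum_of_subset_of_nonneg (Finset.filter_subset _ _)
          fun _ _ _ => Finset.sum_nonneg fun _ _ => by positivity
    _ ≤ _ := sum_sum_primeFactors_inv_le N

open scoped Classical in
lemma exists_count_totient_ge_of_lowerDensity_pos {A : Set ℕ} (hA : 0 < lowerDensity A) :
    ∃ c : ℝ, 0 < c ∧ ∃ ρ : ℝ, 0 < ρ ∧ ∃ K : ℝ, ∀ N : ℕ, ρ * N - K ≤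
      (((Finset.Icc 1 N).filter (· ∈ {n | n ∈ A ∧ c * n ≤ n.totient})).card : ℝ) := by
  obtain ⟨ρ, hρ, hρA⟩ := exists_between hA
  have hev := eventually_lt_of_lt_liminf hρA
    (isBoundedUnder_of ⟨0, fun N => ge_iff_le.mpr (by positivity)⟩)
  obtain ⟨N₀, hN₀⟩ := eventually_atTop.mp hev
  refine ⟨Real.exp (-(2 * (4 / ρ))), Real.exp_pos _, ρ / 2, by positivity, ρ / 2 * N₀,
    fun N => ?_⟩
  rcases lt_or_ge N (N₀ + 1) with h | h
  · have h1 : (N : ℝ) ≤ N₀ := by exact_mod_cast Nat.le_of_lt_succ h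
    have h2 : ρ / 2 * N ≤ ρ / 2 * N₀ := by gcongr
    exact (sub_nonpos.mpr h2).trans (Nat.cast_nonneg _)
  have hN : (0 : ℝ) < N := by exact_mod_cast (by omega : 0 < N)
  have h1 := (lt_div_iff₀ hN).mp (hN₀ N (by omega))
  have h2 := card_filter_lt_sum_primeFactors_inv_le N (t := 4 / ρ) (by positivity)
  have h3 : 2 * N / (4 / ρ) = ρ / 2 * N := by field_simp; ring
  have h4 : (Finset.Icc 1 N).filter (· ∈ A) ⊆
      (Finset.Icc 1 N).filter (· ∈ {n | n ∈ A ∧ Real.exp (-(2 * (4 / ρ))) * n ≤ n.totient}) ∪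
      (Finset.Icc 1 N).filter fun n => 4 / ρ < ∑ p ∈ n.primeFactors, (1 : ℝ) / (p : ℕ) := by
    intro n hn
    simp only [Finset.mem_union, Finset.mem_filter, mem_ofPred_eq] at hn ⊢
    by_cases h : 4 / ρ < ∑ p ∈ n.primeFactors, (1 : ℝ) / (p : ℕ)
    · exact Or.inr ⟨hn.1, h⟩
    · refine Or.inl ⟨hn.1, hn.2, le_trans ?_ (exp_neg_sum_primeFactors_mul_le_totient ?_)⟩
      · have := not_lt.mp h
        gcongr
      · have := (Finset.mem_Icc.mp hn.1).1
        omega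
  have h5 := (Finset.card_le_card h4).trans (Finset.card_union_le _ _)
  have h6 : (((Finset.Icc 1 N).filter (· ∈ A)).card : ℝ) ≤
      ((Finset.Icc 1 N).filter
        (· ∈ {n | n ∈ A ∧ Real.exp (-(2 * (4 / ρ))) * n ≤ n.totient})).card +
      ((Finset.Icc 1 N).filter fun n => 4 / ρ < ∑ p ∈ n.primeFactors, (1 : ℝ) / (p : ℕ)).card := by
    exact_mod_cast h5
  have h7 : 0 ≤ ρ / 2 * (N₀ : ℝ) := by positivity
  linarith

end Density

section QuasiIndependence

/-- Bonferroni's inequality for sets that are pairwise quasi-independent. -/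
lemma le_measureReal_biUnion_of_quasi_indep {Ω : Type*} [MeasurableSpace Ω] {μ : Measure Ω}
    [IsFiniteMeasure μ] {E : ℕ → Set Ω} (hE : ∀ n, MeasurableSet (E n)) {f : ℕ → ℝ}
    {c C : ℝ} (hC : 0 ≤ C) (hlow : ∀ n, c * f n ≤ μ.real (E n))
    (hup : ∀ m n, m ≠ n → μ.real (E m ∩ E n) ≤ C * (f m * f n)) (F : Finset ℕ) :
    c * ∑ n ∈ F, f n - C * (∑ n ∈ F, f n) ^ 2 ≤ μ.real (⋃ n ∈ F, E n) := by
  classical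
  induction F using Finset.induction_on with
  | empty => simp
  | insert a F ha ih =>
    rw [Finset.sum_insert ha, Finset.set_biUnion_insert]
    have h1 := measureReal_union_add_inter (μ := μ) (s := E a)
      (F.measurableSet_biUnion fun n _ => hE n) (measure_ne_top _ _) (measure_ne_top _ _)
    have h2 : μ.real (E a ∩ ⋃ n ∈ F, E n) ≤ C * (f a * ∑ n ∈ F, f n) := by
      rw [inter_iUnion₂, Finset.mul_sum, Finset.mul_sum]
      refine (measureReal_biUnion_finset_le _ _).trans (Finset.sum_le_sum fun n hn => hup _ _ ?_)
      rintro rfl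
      exact ha hn
    nlinarith [hlow a, mul_nonneg hC (sq_nonneg (f a)),
      measureReal_nonneg (μ := μ) (s := E a ∩ ⋃ n ∈ F, E n),
      measureReal_nonneg (μ := μ) (s := E a)]

lemma exists_sum_Ico_mem_Icc {f : ℕ → ℝ} (hf0 : ∀ n, 0 ≤ f n) (hf : ¬ Summable f) {η : ℝ}
    {N : ℕ} (hN : ∀ n ≥ N, f n ≤ η) :
    ∃ M, η ≤ ∑ n ∈ Finset.Ico N M, f n ∧ ∑ n ∈ Finset.Ico N M, f n ≤ 2 * η := by
  have hη : 0 ≤ η := (hf0 N).trans (hN N le_rfl)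
  have hex : ∃ M, η ≤ ∑ n ∈ Finset.Ico N M, f n := by
    by_contra! h
    refine hf (summable_of_sum_range_le (c := ∑ n ∈ Finset.range N, f n + η) hf0 fun n => ?_)
    calc ∑ i ∈ Finset.range n, f i ≤ ∑ i ∈ Finset.range N ∪ Finset.Ico N n, f i := by
          refine Finset.sum_le_sum_of_subset_of_nonneg (fun i hi => ?_) fun i _ _ => hf0 i
          simp at hi ⊢; omega
      _ ≤ ∑ i ∈ Finset.range N, f i + ∑ i ∈ Finset.Ico N n, f i := by
          rw [← Finset.sum_union_inter]
          linarith [Finset.sum_nonneg (s := Finset.range N ∩ Finset.Ico N n) fun i _ => hf0 i]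
      _ ≤ _ := by linarith [h n]
  classical
  refine ⟨Nat.find hex, Nat.find_spec hex, ?_⟩
  rcases lt_or_ge N (Nat.find hex) with h | h
  · obtain ⟨M, hM⟩ : ∃ M, Nat.find hex = M + 1 := ⟨Nat.find hex - 1, by omega⟩
    have h1 := Nat.find_min hex (m := M) (by omega)
    rw [hM, Finset.sum_Ico_succ_top (by omega)]
    linarith [hN M (by omega)]
  · rw [Finset.Ico_eq_empty (by omega)]
    simpa using hη

/-- A quantitative divergence Borel–Cantelli lemma: pairwise quasi-independent events with
divergent sum of probabilities occur infinitely often with positive probability. -/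
lemma not_ae_eventually_notMem_of_quasi_indep {Ω : Type*} [MeasurableSpace Ω] {μ : Measure Ω}
    [IsFiniteMeasure μ] {E : ℕ → Set Ω} (hE : ∀ n, MeasurableSet (E n)) {f : ℕ → ℝ}
    (hf0 : ∀ n, 0 ≤ f n) (hf : ¬ Summable f) (hlim : Tendsto f atTop (𝓝 0))
    {c C : ℝ} (hc : 0 < c) (hC : 0 < C) (hlow : ∀ n, c * f n ≤ μ.real (E n))
    (hup : ∀ m n, m ≠ n → μ.real (E m ∩ E n) ≤ C * (f m * f n)) :
    ¬ ∀ᵐ x ∂μ, ¬ ∃ᶠ n in atTop, x ∈ E n := by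
  set η := c / (4 * C) with hη
  have hη0 : 0 < η := by positivity
  set U : ℕ → Set Ω := fun N => ⋃ n ≥ N, E n with hU
  have hUmeas : ∀ N, MeasurableSet (U N) := fun N =>
    MeasurableSet.iUnion fun n => MeasurableSet.iUnion fun _ => hE n
  have hUanti : Antitone U := fun M N hMN =>
    biUnion_mono (fun n (hn : n ≥ N) => (hMN.trans hn : M ≤ n)) fun _ _ => le_rfl
  have hUlow : ∀ N, η * (c / 2) ≤ μ.real (U N) := by
    intro N
    obtain ⟨N₀, hN₀⟩ := eventually_atTop.mp (hlim.eventually_le_const hη0)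
    obtain ⟨M, hM1, hM2⟩ := exists_sum_Ico_mem_Icc (N := max N N₀) hf0 hf
      fun n hn => hN₀ n ((le_max_right _ _).trans hn)
    have h1 := le_measureReal_biUnion_of_quasi_indep hE hC.le hlow hup
      (Finset.Ico (max N N₀) M)
    have h2 : μ.real (⋃ n ∈ Finset.Ico (max N N₀) M, E n) ≤ μ.real (U N) := by
      refine measureReal_mono (iUnion₂_subset fun n hn =>
        subset_iUnion₂ (s := fun n (_ : n ≥ N) => E n) n ?_) (measure_ne_top _ _)
      exact (le_max_left _ _).trans (Finset.mem_Ico.mp hn).1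
    refine le_trans ?_ (h1.trans h2)
    set S := ∑ n ∈ Finset.Ico (max N N₀) M, f n
    have h3 : C * S ≤ c / 2 := by
      calc C * S ≤ C * (2 * η) := by gcongr
        _ = c / 2 := by rw [hη]; field_simp; ring
    have h4 : c * S - C * S ^ 2 = S * (c - C * S) := by ring
    rw [h4]
    exact mul_le_mul hM1 (by linarith) (by positivity) (by linarith)
  intro hae
  have h0 : μ (⋂ N, U N) = 0 := by
    refine measure_mono_null (fun x hx => ?_) hae
    simp only [hU, mem_iInter, mem_iUnion, exists_prop] at hx
    simpa [frequently_atTop] using hx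
  have ht := tendsto_measure_iInter_atTop (μ := μ) (fun N => (hUmeas N).nullMeasurableSet) hUanti
    ⟨0, measure_ne_top _ _⟩
  rw [h0] at ht
  have h1 : ENNReal.ofReal (η * (c / 2)) ≤ 0 := ge_of_tendsto' ht fun N =>
    (ENNReal.ofReal_le_iff_le_toReal (measure_ne_top _ _)).mpr (hUlow N)
  have : 0 < η * (c / 2) := by positivity
  simp only [nonpos_iff_eq_zero, ENNReal.ofReal_eq_zero] at h1
  linarith

end QuasiIndependence

section Overlap

open Metric

lemma card_le_of_torsion_of_norm_lt {L : ℕ} (hL : 0 < L) {ε : ℝ} (hε : 0 ≤ ε)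
    {S : Finset UnitAddCircle} (hS : ∀ w ∈ S, L • w = 0 ∧ w ≠ 0 ∧ ‖w‖ < ε) :
    (S.card : ℝ) ≤ 2 * (ε * L) := by
  classical
  have hL0 : (0 : ℝ) < L := by exact_mod_cast hL
  set M : ℕ := ⌊ε * L⌋₊
  have hsub : S ⊆ ((Finset.Icc (-M : ℤ) M).erase 0).image
      fun j : ℤ => ((j / L : ℝ) : UnitAddCircle) := by
    intro w hw
    obtain ⟨h1, h2, h3⟩ := hS w hw
    induction w using QuotientAddGroup.induction_on with | _ t =>
    set x : ℝ := t - round t with hx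
    have hxw : ((t : ℝ) : UnitAddCircle) = ((x : ℝ) : UnitAddCircle) := by
      rw [hx, AddCircle.coe_sub]
      have : ((round t : ℝ) : UnitAddCircle) = 0 :=
        AddCircle.coe_eq_zero_iff 1 |>.mpr ⟨round t, by simp⟩
      rw [this, sub_zero]
    change ‖((t : ℝ) : UnitAddCircle)‖ < ε at h3
    rw [UnitAddCircle.norm_eq] at h3
    change ((t : ℝ) : UnitAddCircle) ≠ 0 at h2
    change L • ((t : ℝ) : UnitAddCircle) = 0 at h1
    rw [hxw] at h1 h2
    rw [← AddCircle.coe_nsmul, AddCircle.coe_eq_zero_iff] at h1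
    obtain ⟨j, hj⟩ := h1
    simp only [zsmul_eq_mul, mul_one, nsmul_eq_mul] at hj
    have hxj : x = j / L := by field_simp; linarith
    refine Finset.mem_image.mpr ⟨j, ?_, ?_⟩
    · have hj0 : j ≠ 0 := by
        rintro rfl
        exact h2 (by simp [hxj])
      have hjM : |(j : ℝ)| < ε * L := by
        rw [hj, abs_mul, abs_of_pos hL0, mul_comm]
        gcongr
      have : j.natAbs ≤ M := Nat.le_floor (by
        rw [Nat.cast_natAbs, Int.cast_abs]; exact hjM.le)
      simp only [Finset.mem_erase, Finset.mem_Icc]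
      omega
    · change _ = ((t : ℝ) : UnitAddCircle)
      rw [hxw, hxj]
  have hcard := (Finset.card_le_card hsub).trans Finset.card_image_le
  rw [Finset.card_erase_of_mem (by simp), Int.card_Icc] at hcard
  have h4 : S.card ≤ 2 * M := by omega
  have h5 : (M : ℝ) ≤ ε * L := Nat.floor_le (by positivity)
  calc (S.card : ℝ) ≤ 2 * M := by exact_mod_cast h4
    _ ≤ _ := by gcongr

lemma card_torsion_le {n : ℕ} (hn : 0 < n) {S : Finset UnitAddCircle}
    (hS : ∀ w ∈ S, n • w = 0) : S.card ≤ n := by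
  have h1 := AddCircle.card_torsion_le_of_isSMulRegular (1 : ℝ) n hn.ne'
    (.of_right_eq_zero_of_smul fun _ ↦ by simp [hn.ne'])
  have h2 : (S : Set UnitAddCircle).encard ≤ {x : AddCircle (1 : ℝ) | n • x = 0}.encard :=
    encard_le_encard fun w hw => hS w hw
  have h3 := h2.trans h1
  rw [encard_coe_eq_coe_finsetCard] at h3
  exact_mod_cast h3

lemma card_close_pairs_le {q r : ℕ} (hq : 0 < q) (hr : 0 < r) (hqr : q ≠ r) {ε : ℝ} (hε : 0 ≤ ε)
    {S : Finset (UnitAddCircle × UnitAddCircle)}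
    (hS : ∀ y ∈ S, addOrderOf y.1 = q ∧ addOrderOf y.2 = r ∧ ‖y.1 - y.2‖ < ε) :
    (S.card : ℝ) ≤ 2 * (ε * (q * r)) := by
  classical
  have hq' : ∀ y ∈ S, q • y.1 = 0 := fun y hy => by
    rw [← (hS y hy).1]; exact addOrderOf_nsmul_eq_zero _
  have hr' : ∀ y ∈ S, r • y.2 = 0 := fun y hy => by
    rw [← (hS y hy).2.1]; exact addOrderOf_nsmul_eq_zero _
  have hfib : ∀ w ∈ S.image (fun y => y.1 - y.2),
      (S.filter fun y => y.1 - y.2 = w).card ≤ q.gcd r := by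
    intro w hw
    obtain ⟨z, hz, rfl⟩ := Finset.mem_image.mp hw
    rw [← Finset.card_image_of_injOn (f := fun y => y.1 - z.1)]
    · refine card_torsion_le (Nat.gcd_pos_of_pos_left _ hq) fun u hu => ?_
      obtain ⟨y, hy, rfl⟩ := Finset.mem_image.mp hu
      obtain ⟨hy, hyz⟩ := Finset.mem_filter.mp hy
      have h1 : y.1 - z.1 = y.2 - z.2 := by
        rw [sub_eq_sub_iff_add_eq_add] at hyz ⊢
        rw [hyz, add_comm]
      rw [← addOrderOf_dvd_iff_nsmul_eq_zero]
      refine Nat.dvd_gcd ?_ ?_ <;> rw [addOrderOf_dvd_iff_nsmul_eq_zero]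
      · rw [smul_sub, hq' y hy, hq' z hz, sub_zero]
      · rw [h1, smul_sub, hr' y hy, hr' z hz, sub_zero]
    · intro y hy y' hy' h
      have hy2 := (Finset.mem_filter.mp hy).2
      have hy2' := (Finset.mem_filter.mp hy').2
      have h1 : y.1 = y'.1 := by simpa using h
      refine Prod.ext h1 ?_
      rw [← hy2', h1] at hy2
      simpa using hy2
  have hcard := Finset.card_le_mul_card_image S _ hfib
  have himg : ((S.image fun y => y.1 - y.2).card : ℝ) ≤ 2 * (ε * (q.lcm r : ℕ)) := by
    refine card_le_of_torsion_of_norm_lt (Nat.lcm_pos hq hr) hε fun w hw => ?_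
    obtain ⟨y, hy, rfl⟩ := Finset.mem_image.mp hw
    obtain ⟨h1, h2, h3⟩ := hS y hy
    refine ⟨?_, fun h => hqr ?_, h3⟩
    · obtain ⟨a, ha⟩ := Nat.dvd_lcm_left q r
      obtain ⟨b, hb⟩ := Nat.dvd_lcm_right q r
      rw [smul_sub]
      nth_rw 1 [ha]
      rw [hb, mul_comm q, mul_comm r, mul_smul, mul_smul, hq' y hy, hr' y hy]
      simp
    · rw [← h1, ← h2, sub_eq_zero.mp h]
  calc (S.card : ℝ) ≤ (q.gcd r : ℕ) * ((S.image fun y => y.1 - y.2).card : ℕ) := by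
        exact_mod_cast hcard
    _ ≤ (q.gcd r : ℕ) * (2 * (ε * (q.lcm r : ℕ))) := by gcongr
    _ = 2 * (ε * ((q.gcd r * q.lcm r : ℕ) : ℝ)) := by push_cast; ring
    _ = _ := by rw [Nat.gcd_mul_lcm]; push_cast; ring

lemma approxAddOrderOf_eq_biUnion {n : ℕ} (hn : 0 < n) (δ : ℝ) :
    approxAddOrderOf UnitAddCircle n δ =
      ⋃ y ∈ (AddCircle.finite_setOfPred_addOrderOf_eq (p := (1 : ℝ)) hn).toFinset, ball y δ := by
  simp [approxAddOrderOf, thickening_eq_biUnion_ball]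

lemma measureReal_ball_le (y : UnitAddCircle) {δ : ℝ} (hδ : 0 ≤ δ) :
    volume.real (ball y δ) ≤ 2 * δ := by
  rw [Measure.real, ← measure_congr AddCircle.closedBall_ae_eq_ball, AddCircle.volume_closedBall]
  rw [ENNReal.toReal_ofReal (by positivity)]
  exact min_le_right _ _

lemma measureReal_inter_approxAddOrderOf_le {q r : ℕ} (hq : 0 < q) (hr : 0 < r) (hqr : q ≠ r)
    {δ ε : ℝ} (hδ : 0 ≤ δ) (hε : 0 ≤ ε) :
    volume.real (approxAddOrderOf UnitAddCircle q δ ∩ approxAddOrderOf UnitAddCircle r ε)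
      ≤ 8 * ((q * δ) * (r * ε)) := by
  classical
  set S := ((AddCircle.finite_setOfPred_addOrderOf_eq (p := (1 : ℝ)) hq).toFinset ×ˢ
    (AddCircle.finite_setOfPred_addOrderOf_eq (p := (1 : ℝ)) hr).toFinset).filter
      fun y => ‖y.1 - y.2‖ < δ + ε with hS
  have hsub : approxAddOrderOf UnitAddCircle q δ ∩ approxAddOrderOf UnitAddCircle r ε ⊆
      ⋃ y ∈ S, ball y.1 δ ∩ ball y.2 ε := by
    rintro x ⟨hx, hx'⟩
    obtain ⟨y, hy, hxy⟩ := mem_approx_add_orderOf_iff.mp hx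
    obtain ⟨z, hz, hxz⟩ := mem_approx_add_orderOf_iff.mp hx'
    refine mem_iUnion₂.mpr ⟨(y, z), ?_, hxy, hxz⟩
    simp only [hS, Finset.mem_filter, Finset.mem_product, Finite.mem_toFinset, mem_ofPred_eq]
    refine ⟨⟨hy, hz⟩, ?_⟩
    rw [← dist_eq_norm]
    rw [mem_ball, dist_comm] at hxy
    exact (dist_triangle y x z).trans_lt (add_lt_add hxy hxz)
  have hcard : (S.card : ℝ) ≤ 2 * ((δ + ε) * (q * r)) := by
    refine card_close_pairs_le hq hr hqr (by positivity) fun y hy => ?_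
    simpa [hS, and_assoc] using hy
  have hball : ∀ y ∈ S, volume.real (ball y.1 δ ∩ ball y.2 ε) ≤ 2 * min δ ε := by
    intro y _
    rw [mul_min_of_nonneg _ _ zero_le_two]
    exact le_min ((measureReal_mono inter_subset_left).trans (measureReal_ball_le _ hδ))
      ((measureReal_mono inter_subset_right).trans (measureReal_ball_le _ hε))
  have hmin : 0 ≤ min δ ε := le_min hδ hε
  calc _ ≤ volume.real (⋃ y ∈ S, ball y.1 δ ∩ ball y.2 ε) :=
        measureReal_mono hsub (measure_ne_top _ _)
    _ ≤ ∑ y ∈ S, volume.real (ball y.1 δ ∩ ball y.2 ε) := measureReal_biUnion_finset_le _ _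
    _ ≤ S.card • (2 * min δ ε) := Finset.sum_le_card_nsmul _ _ _ hball
    _ ≤ 2 * ((δ + ε) * (q * r)) * (2 * min δ ε) := by rw [nsmul_eq_mul]; gcongr
    _ ≤ _ := by
        have h1 : (δ + ε) * min δ ε ≤ 2 * (δ * ε) := by
          rw [← max_add_min δ ε, ← max_mul_min δ ε]
          nlinarith [min_le_max (a := δ) (b := ε)]
        have h2 : (0 : ℝ) ≤ 4 * (q * r) := by positivity
        nlinarith [mul_le_mul_of_nonneg_left h1 h2]

lemma measureReal_approxAddOrderOf {q : ℕ} (hq : 0 < q) {δ : ℝ} (hδ : 0 ≤ δ)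
    (hδq : 2 * δ * q ≤ 1) :
    volume.real (approxAddOrderOf UnitAddCircle q δ) = q.totient * (2 * δ) := by
  have hq1 : (1 : ℝ) ≤ q := by exact_mod_cast hq
  rw [approxAddOrderOf_eq_biUnion hq, measureReal_biUnion_finset]
  · have hball : ∀ y : UnitAddCircle, volume.real (ball y δ) = 2 * δ := fun y => by
      rw [Measure.real, ← measure_congr AddCircle.closedBall_ae_eq_ball,
        AddCircle.volume_closedBall, min_eq_right (by nlinarith),
        ENNReal.toReal_ofReal (by positivity)]
    simp_rw [hball]
    rw [Finset.sum_const, nsmul_eq_mul,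
      ← Set.ncard_eq_toFinset_card _ (AddCircle.finite_setOfPred_addOrderOf_eq (p := (1 : ℝ)) hq)]
    congr 2
    exact AddCircle.card_addOrderOf_eq_totient (1 : ℝ)
  · intro y hy z hz hyz
    simp only [Finite.coe_toFinset, mem_ofPred_eq] at hy hz
    refine ball_disjoint_ball ?_
    have hd : q • (y - z) = 0 := by
      rw [smul_sub]
      nth_rw 1 [← hy]
      rw [← hz, addOrderOf_nsmul_eq_zero, addOrderOf_nsmul_eq_zero, sub_zero]
    have hfin : IsOfFinAddOrder (y - z) := isOfFinAddOrder_iff_nsmul_eq_zero.mpr ⟨q, hq, hd⟩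
    have h1 := AddCircle.le_add_order_smul_norm_of_isOfFinAddOrder hfin (sub_ne_zero.mpr hyz)
    have h2 : (addOrderOf (y - z) : ℝ) ≤ q := by
      exact_mod_cast Nat.le_of_dvd hq (addOrderOf_dvd_of_nsmul_eq_zero hd)
    rw [nsmul_eq_mul, ← dist_eq_norm] at h1
    have h3 : 1 ≤ q * dist y z := h1.trans (by gcongr)
    have h4 : (0 : ℝ) < q := by linarith
    nlinarith
  · exact fun y _ => measurableSet_ball

end Overlap

section OneSided

open Metric

/-- One-sided form of approximability: passing from two-sided to one-sided neighbourhoods of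
the points of exact order `n` does not change the limsup set up to null sets. -/
lemma ae_frequently_dist_add_le_of_ae_mem_addWellApproximable {δ : ℕ → ℝ}
    (hδ : Tendsto δ atTop (𝓝 0))
    (h : ∀ᵐ x : UnitAddCircle, x ∈ addWellApproximable UnitAddCircle δ) :
    ∀ᵐ x : UnitAddCircle, ∃ᶠ n in atTop, 0 < δ n ∧
      ∃ y : UnitAddCircle, addOrderOf y = n ∧ dist x (y + ((δ n : ℝ) : UnitAddCircle)) ≤ δ n := by
  set s : ℕ → Set UnitAddCircle := fun n =>
    (fun y => y + ((δ n : ℝ) : UnitAddCircle)) '' {y | addOrderOf y = n} with hs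
  have key := blimsup_cthickening_mul_ae_eq (volume : Measure UnitAddCircle)
    (fun n => 0 < n ∧ 0 < δ n) s two_pos δ hδ
  filter_upwards [h, key.mem_iff] with x hx hiff
  rw [← Nat.cofinite_eq_atTop, cofinite.blimsup_set_eq, cofinite.blimsup_set_eq] at hiff
  rw [mem_add_wellApproximable_iff, ← Nat.cofinite_eq_atTop, cofinite.blimsup_set_eq] at hx
  simp only [mem_ofPred_eq] at hiff hx
  have h2 := hiff.mp (hx.mono fun n hn => ?_)
  · rw [Nat.frequently_atTop_iff_infinite]
    refine h2.mono fun n hn => ?_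
    obtain ⟨⟨hn0, hδn⟩, hxn⟩ := hn
    refine ⟨hδn, ?_⟩
    have hcpt : IsCompact (s n) :=
      ((AddCircle.finite_setOfPred_addOrderOf_eq (p := (1 : ℝ)) hn0).image _).isCompact
    rw [hcpt.cthickening_eq_biUnion_closedBall hδn.le] at hxn
    obtain ⟨_, ⟨y, hy, rfl⟩, hxy⟩ := mem_iUnion₂.mp hxn
    exact ⟨y, hy, hxy⟩
  · obtain ⟨hn0, hxn⟩ := hn
    obtain ⟨y, hy, hxy⟩ := mem_approx_add_orderOf_iff.mp hxn
    have hδn : 0 < δ n := pos_of_mem_ball hxy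
    refine ⟨⟨hn0, hδn⟩, mem_cthickening_of_dist_le x (y + ((δ n : ℝ) : UnitAddCircle)) _ _
      ⟨y, hy, rfl⟩ ?_⟩
    have h3 : dist y (y + ((δ n : ℝ) : UnitAddCircle)) ≤ δ n := by
      rw [dist_eq_norm, sub_add_cancel_left, norm_neg]
      rw [UnitAddCircle.norm_eq]
      simpa [abs_of_pos hδn] using round_le (δ n) 0
    have h4 := dist_triangle x y (y + ((δ n : ℝ) : UnitAddCircle))
    rw [mem_ball] at hxy
    linarith

lemma exists_coprime_of_dist_add_le {x δ : ℝ} {n : ℕ} (hn : 0 < n) {y : UnitAddCircle}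
    (hy : addOrderOf y = n)
    (h : dist (x : UnitAddCircle) (y + ((δ : ℝ) : UnitAddCircle)) ≤ δ) :
    ∃ p : ℤ, IsCoprime p (n : ℤ) ∧ 0 ≤ x - p / n ∧ x - p / n ≤ 2 * δ := by
  obtain ⟨m, -, hm, rfl⟩ := (AddCircle.addOrderOf_eq_pos_iff hn).mp hy
  rw [dist_eq_norm, ← AddCircle.coe_add, ← AddCircle.coe_sub, UnitAddCircle.norm_eq,
    abs_le] at h
  set k := round (x - (m / n * 1 + δ))
  have hn0 : (n : ℝ) ≠ 0 := by exact_mod_cast hn.ne'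
  have hp : (((m : ℤ) + k * n : ℤ) : ℝ) / n = m / n * 1 + k := by
    push_cast
    field_simp
  refine ⟨m + k * n, ?_, ?_, ?_⟩
  · exact (Nat.isCoprime_iff_coprime.mpr hm).add_mul_right_left k
  · rw [hp]; linarith
  · rw [hp]; linarith

end OneSided

/-- A Duffin–Schaeffer type theorem for weights supported where `φ(q) / q` is bounded below,
with one-sided approximation. -/
lemma ae_frequently_coprime_one_sided {f : ℕ → ℝ} (hf0 : ∀ n, 0 ≤ f n) (hf : ¬ Summable f)
    (hf1 : ∀ n : ℕ, f n ≤ 1 / n) {c : ℝ} (hc : 0 < c)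
    (hφ : ∀ n, f n ≠ 0 → c * n ≤ n.totient) :
    ∀ᵐ x : UnitAddCircle, ∃ᶠ n : ℕ in atTop, 0 < f n ∧ ∃ p : ℤ, IsCoprime p (n : ℤ) ∧
      0 ≤ iota x - p / n ∧ iota x - p / n ≤ f n / (2 * n) := by
  have hf00 : f 0 = 0 := le_antisymm (by simpa using hf1 0) (hf0 0)
  have hlim : Tendsto f atTop (𝓝 0) :=
    squeeze_zero hf0 hf1 tendsto_one_div_atTop_nhds_zero_nat
  have hle1 : ∀ n, f n ≤ 1 := fun n => by
    rcases Nat.eq_zero_or_pos n with rfl | hn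
    · rw [hf00]; exact zero_le_one
    · refine (hf1 n).trans ?_
      rw [div_le_one (by exact_mod_cast hn)]
      exact_mod_cast hn
  set δ : ℕ → ℝ := fun n => f n / (4 * n) with hδ
  have hδ0 : ∀ n, 0 ≤ δ n := fun n => by have := hf0 n; positivity
  have hnδ : ∀ n, n * δ n = f n / 4 := fun n => by
    rcases Nat.eq_zero_or_pos n with rfl | hn
    · simp [hf00]
    · simp only [hδ]
      field_simp
  have hδlim : Tendsto δ atTop (𝓝 0) := by
    refine squeeze_zero hδ0 (fun n => ?_) hlim
    rcases Nat.eq_zero_or_pos n with rfl | hn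
    · simp [hδ, hf00]
    · have : (1 : ℝ) ≤ n := by exact_mod_cast hn
      exact div_le_self (hf0 n) (by linarith)
  have hpos : ¬ ∀ᵐ x : UnitAddCircle, x ∉ addWellApproximable UnitAddCircle δ := by
    have h1 := not_ae_eventually_notMem_of_quasi_indep (μ := (volume : Measure UnitAddCircle))
      (E := fun n => approxAddOrderOf UnitAddCircle n (δ n))
      (fun n => Metric.isOpen_thickening.measurableSet) hf0 hf hlim (c := c / 2) (C := 1 / 2)
      (by positivity) (by positivity) ?_ ?_
    · refine fun h => h1 (h.mono fun x hx hx' => hx ?_)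
      rw [mem_add_wellApproximable_iff, ← Nat.cofinite_eq_atTop, cofinite.blimsup_set_eq]
      rw [← Nat.cofinite_eq_atTop] at hx'
      refine (frequently_cofinite_iff_infinite.mp hx').mono fun n hn => ⟨?_, hn⟩
      refine Nat.pos_of_ne_zero ?_
      rintro rfl
      have : approxAddOrderOf UnitAddCircle 0 (δ 0) = ∅ :=
        Metric.thickening_of_nonpos (by simp [hδ]) _
      change x ∈ approxAddOrderOf UnitAddCircle 0 (δ 0) at hn
      rwa [this] at hn
    · intro n
      rcases eq_or_ne (f n) 0 with h | h
      · rw [h, mul_zero]; exact measureReal_nonneg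
      have hn : 0 < n := Nat.pos_of_ne_zero fun h0 => h (h0 ▸ hf00)
      rw [measureReal_approxAddOrderOf hn (hδ0 n)]
      · calc c / 2 * f n = c * n * (2 * δ n) := by
              rw [mul_assoc, mul_left_comm (n : ℝ), hnδ]; ring
          _ ≤ _ := by
              have := hδ0 n
              gcongr
              exact hφ n h
      · have := hnδ n
        have := hle1 n
        nlinarith
    · intro m n hmn
      have h0 : ∀ k, k = 0 → approxAddOrderOf UnitAddCircle k (δ k) = ∅ := by
        rintro _ rfl
        exact Metric.thickening_of_nonpos (by simp [hδ]) _
      have hnn : 0 ≤ 1 / 2 * (f m * f n) := by have := hf0 m; have := hf0 n; positivity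
      rcases Nat.eq_zero_or_pos m with hm | hm
      · rw [h0 m hm, empty_inter]; simpa using hnn
      rcases Nat.eq_zero_or_pos n with hn | hn
      · rw [h0 n hn, inter_empty]; simpa using hnn
      refine (measureReal_inter_approxAddOrderOf_le hm hn hmn (hδ0 m) (hδ0 n)).trans_eq ?_
      rw [hnδ, hnδ]
      ring
  have hae := (AddCircle.addWellApproximable_ae_empty_or_univ (T := 1) δ hδlim).resolve_left hpos
  filter_upwards [ae_frequently_dist_add_le_of_ae_mem_addWellApproximable hδlim hae] with x hx
  refine hx.mono fun n hn => ?_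
  obtain ⟨hδn, y, hy, hxy⟩ := hn
  have hn0 : 0 < n := Nat.pos_of_ne_zero fun h0 => by simp [h0, hδ] at hδn
  have hiota : ((iota x : ℝ) : UnitAddCircle) = x :=
    (AddCircle.equivIco 1 0).symm_apply_apply x
  rw [← hiota] at hxy
  obtain ⟨p, hp, h1, h2⟩ := exists_coprime_of_dist_add_le hn0 hy hxy
  refine ⟨(hf0 n).lt_of_ne' fun h => by simp [hδ, h] at hδn, p, hp, h1, h2.trans_eq ?_⟩
  simp only [hδ]
  field_simp
  ring

section ContinuedFraction

variable {x : ℝ}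

lemma irrational_gaussIter (hx : Irrational x) (k : ℕ) : Irrational (gaussIter x k) := by
  induction k with
  | zero => exact hx.sub_intCast _
  | succ k ih =>
    have h : Irrational (1 / gaussIter x k) := by simpa using ih.inv
    exact h.sub_intCast _

lemma gaussIter_nonneg (x : ℝ) (k : ℕ) : 0 ≤ gaussIter x k := by
  cases k <;> exact Int.fract_nonneg _

lemma gaussIter_lt_one (x : ℝ) (k : ℕ) : gaussIter x k < 1 := by
  cases k <;> exact Int.fract_lt_one _

lemma gaussIter_pos (hx : Irrational x) (k : ℕ) : 0 < gaussIter x k :=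
  (gaussIter_nonneg x k).lt_of_ne' (irrational_gaussIter hx k).ne_zero

lemma one_div_gaussIter (x : ℝ) (k : ℕ) :
    1 / gaussIter x k = cfA x (k + 1) + gaussIter x (k + 1) := by
  have h : 0 ≤ 1 / gaussIter x k := one_div_nonneg.mpr (gaussIter_nonneg x k)
  rw [cfA, Nat.add_sub_cancel, gaussIter, natCast_floor_eq_intCast_floor h]
  exact (Int.floor_add_fract _).symm

lemma one_le_cfA_succ (hx : Irrational x) (k : ℕ) : 1 ≤ cfA x (k + 1) := by
  refine Nat.le_floor ?_
  rw [Nat.cast_one, Nat.add_sub_cancel, one_le_div (gaussIter_pos hx k)]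
  exact (gaussIter_lt_one x k).le

lemma cfQ_le_succ (hx : Irrational x) (k : ℕ) : cfQ x k ≤ cfQ x (k + 1) := by
  cases k with
  | zero => exact one_le_cfA_succ hx 0
  | succ k =>
    rw [cfQ]
    nlinarith [one_le_cfA_succ hx (k + 1), Nat.zero_le (cfQ x k)]

lemma cfQ_succ_le (hx : Irrational x) (k : ℕ) :
    cfQ x (k + 1) ≤ (cfA x (k + 1) + 1) * cfQ x k := by
  cases k with
  | zero => simp [cfQ]
  | succ k =>
    rw [cfQ]
    nlinarith [cfQ_le_succ hx k]

lemma two_pow_le_cfQ (hx : Irrational x) (k : ℕ) : 2 ^ (k / 2) ≤ cfQ x k := by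
  induction k using Nat.twoStepInduction with
  | zero => simp [cfQ]
  | one => exact one_le_cfA_succ hx 0
  | more k ih _ =>
    rw [cfQ, Nat.add_div_right k two_pos, pow_succ]
    nlinarith [one_le_cfA_succ hx (k + 1), cfQ_le_succ hx k]

lemma cfQ_pos (hx : Irrational x) (k : ℕ) : 0 < cfQ x k :=
  (Nat.two_pow_pos _).trans_le (two_pow_le_cfQ hx k)

lemma cfQ_mul_cfP_succ_sub (x : ℝ) (k : ℕ) :
    (cfQ x k * cfP x (k + 1) - cfP x k * cfQ x (k + 1) : ℤ) = (-1) ^ k := by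
  induction k with
  | zero => simp [cfQ, cfP]
  | succ k ih =>
    rw [cfQ, cfP, pow_succ, ← ih]
    push_cast
    ring

/-- The signed error `q_k x - p_k` of the `k`-th convergent. -/
noncomputable def cfErr (x : ℝ) (k : ℕ) : ℝ := cfQ x k * x - cfP x k

lemma cfErr_succ (hx : Irrational x) (hx0 : 0 ≤ x) (hx1 : x < 1) (k : ℕ) :
    cfErr x (k + 1) = -gaussIter x (k + 1) * cfErr x k := by
  have hg (k : ℕ) : gaussIter x k * (cfA x (k + 1) + gaussIter x (k + 1)) = 1 := by
    rw [← one_div_gaussIter, mul_one_div_cancel (gaussIter_pos hx k).ne']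
  induction k with
  | zero =>
    have h := hg 0
    rw [gaussIter, Int.fract_eq_self.mpr ⟨hx0, hx1⟩] at h
    simp only [cfErr, cfQ, cfP, zero_add, Nat.cast_one, Nat.cast_zero] at h ⊢
    linarith
  | succ k ih =>
    have h : cfErr x (k + 2) = cfA x (k + 2) * cfErr x (k + 1) + cfErr x k := by
      simp only [cfErr, cfQ, cfP]
      push_cast
      ring
    rw [h]
    linear_combination (cfA x (k + 2) + gaussIter x (k + 2)) * ih - cfErr x k * hg (k + 1)

lemma neg_one_pow_mul_cfErr_pos (hx : Irrational x) (hx0 : 0 ≤ x) (hx1 : x < 1) (k : ℕ) :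
    0 < (-1) ^ k * cfErr x k := by
  induction k with
  | zero => simpa [cfErr, cfQ, cfP] using hx0.lt_of_ne' hx.ne_zero
  | succ k ih =>
    rw [cfErr_succ hx hx0 hx1, pow_succ]
    have := mul_pos (gaussIter_pos hx (k + 1)) ih
    linarith

lemma cfErr_mul_cfQ_succ_add (hx : Irrational x) (hx0 : 0 ≤ x) (hx1 : x < 1) (k : ℕ) :
    cfErr x k * (cfQ x (k + 1) + cfQ x k * gaussIter x (k + 1)) = (-1) ^ k := by
  have h : (cfQ x k * cfP x (k + 1) - cfP x k * cfQ x (k + 1) : ℝ) = (-1) ^ k := by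
    exact_mod_cast cfQ_mul_cfP_succ_sub x k
  have h1 := cfErr_succ hx hx0 hx1 k
  rw [← h]
  have h2 : (cfQ x k * cfP x (k + 1) - cfP x k * cfQ x (k + 1) : ℝ)
      = cfErr x k * cfQ x (k + 1) - cfQ x k * cfErr x (k + 1) := by
    simp only [cfErr]
    ring
  rw [h2, h1]
  ring

/-- A small error of the `k`-th convergent forces a large next partial quotient. -/
lemma one_le_cfErr_mul_cfA (hx : Irrational x) (hx0 : 0 ≤ x) (hx1 : x < 1) {k : ℕ}
    (hk : Even k) : 1 ≤ cfErr x k * (3 * cfA x (k + 1) * cfQ x k) := by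
  have hpos := neg_one_pow_mul_cfErr_pos hx hx0 hx1 k
  have h := cfErr_mul_cfQ_succ_add hx hx0 hx1 k
  rw [hk.neg_one_pow] at h hpos
  rw [one_mul] at hpos
  rw [← h]
  gcongr
  have h1 : (cfQ x (k + 1) : ℝ) ≤ (cfA x (k + 1) + 1) * cfQ x k := by
    exact_mod_cast cfQ_succ_le hx k
  have h2 : (1 : ℝ) ≤ cfA x (k + 1) := by exact_mod_cast one_le_cfA_succ hx k
  have h3 : (0 : ℝ) ≤ cfQ x k := Nat.cast_nonneg _
  nlinarith [gaussIter_lt_one x (k + 1)]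

lemma exists_cfQ_le_lt (hx : Irrational x) {q : ℕ} (hq : 0 < q) :
    ∃ k, cfQ x k ≤ q ∧ q < cfQ x (k + 1) := by
  have hex : ∃ k, q < cfQ x (k + 1) := by
    refine ⟨2 * q, q.lt_two_pow_self.trans_le ?_⟩
    have := two_pow_le_cfQ hx (2 * q)
    rw [Nat.mul_div_cancel_left q two_pos] at this
    exact this.trans (cfQ_le_succ hx _)
  classical
  refine ⟨Nat.find hex, ?_, Nat.find_spec hex⟩
  rcases h : Nat.find hex with _ | j
  · exact hq
  · exact not_lt.mp (Nat.find_min hex (m := j) (by omega))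

/-- Legendre's criterion: a reduced fraction `p / q` with `|x - p / q| < 1 / (2 q ^ 2)` is a
convergent of `x`. -/
lemma exists_cf_eq_of_abs_lt (hx : Irrational x) (hx0 : 0 ≤ x) (hx1 : x < 1) {q : ℕ} (hq : 0 < q)
    {p : ℤ} (hpq : IsCoprime p (q : ℤ)) (h : q * |q * x - p| < 1 / 2) :
    ∃ k, cfQ x k = q ∧ (cfP x k : ℤ) = p := by
  obtain ⟨k, hk, hk'⟩ := exists_cfQ_le_lt hx hq
  refine ⟨k, ?_⟩
  have hdet := cfQ_mul_cfP_succ_sub x k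
  have hsq : ((-1) ^ k : ℤ) * (-1) ^ k = 1 := by rw [← mul_pow]; simp
  set s : ℤ := (-1) ^ k with hs
  obtain ⟨v, hv⟩ : ∃ v : ℤ, v = s * (cfQ x k * p - cfP x k * q) := ⟨_, rfl⟩
  obtain ⟨u, hu⟩ : ∃ u : ℤ, u = s * (cfP x (k + 1) * q - cfQ x (k + 1) * p) := ⟨_, rfl⟩
  have hq' : (q : ℤ) = u * cfQ x k + v * cfQ x (k + 1) := by
    rw [hu, hv]
    linear_combination (-q : ℤ) * hsq - s * q * hdet
  have hp' : p = u * cfP x k + v * cfP x (k + 1) := by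
    rw [hu, hv]
    linear_combination (-p : ℤ) * hsq - s * p * hdet
  have hqk : 0 < (cfQ x k : ℤ) := by exact_mod_cast cfQ_pos hx k
  have hkz : (q : ℤ) < cfQ x (k + 1) := by exact_mod_cast hk'
  have hqz : 0 < (q : ℤ) := by exact_mod_cast hq
  rcases eq_or_ne v 0 with hv0 | hv0
  · rw [hv0, zero_mul, add_zero] at hq' hp'
    have hunit : IsUnit u := hpq.isUnit_of_dvd' ⟨_, hp'⟩ ⟨_, hq'⟩
    have hu1 : u = 1 := by
      rcases Int.isUnit_iff.mp hunit with h1 | h1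
      · exact h1
      · rw [h1] at hq'; omega
    rw [hu1, one_mul] at hq' hp'
    exact ⟨by exact_mod_cast hq'.symm, hp'.symm⟩
  exfalso
  have he := neg_one_pow_mul_cfErr_pos hx hx0 hx1 k
  have he' := neg_one_pow_mul_cfErr_pos hx hx0 hx1 (k + 1)
  have hsr : ((-1) ^ k : ℝ) = s := by rw [hs]; push_cast; rfl
  rw [pow_succ, hsr] at he'
  rw [hsr] at he
  have hsabs : |(s : ℝ)| = 1 := by rw [← hsr]; simp
  have hE : (q * x - p : ℝ) = u * cfErr x k + v * cfErr x (k + 1) := by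
    have h1 : (q : ℝ) = u * cfQ x k + v * cfQ x (k + 1) := by exact_mod_cast hq'
    have h2 : (p : ℝ) = u * cfP x k + v * cfP x (k + 1) := by exact_mod_cast hp'
    rw [h1, h2, cfErr, cfErr]
    ring
  have hmain : |cfErr x k| ≤ |q * x - p| := by
    have e1 : |cfErr x k| = s * cfErr x k := by
      rw [← abs_of_pos he, abs_mul, hsabs, one_mul]
    have e2 : |q * x - p| = |u * (s * cfErr x k) - v * (s * -1 * cfErr x (k + 1))| := by
      have : |q * x - p| = |s * (q * x - p)| := by rw [abs_mul, hsabs, one_mul]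
      rw [this, hE]
      congr 1
      ring
    rw [e1, e2]
    set g := s * cfErr x k
    set g' := s * -1 * cfErr x (k + 1)
    rcases lt_or_gt_of_ne hv0 with hv1 | hv1
    · have hu1 : 1 ≤ u := by
        by_contra! hu1
        nlinarith
      have hu2 : (1 : ℝ) ≤ u := by exact_mod_cast hu1
      have hv2 : (v : ℝ) < 0 := by exact_mod_cast hv1
      refine le_trans ?_ (le_abs_self _)
      nlinarith
    · have hu1 : u ≤ -1 := by
        by_contra! hu1
        nlinarith
      have hu2 : (u : ℝ) ≤ -1 := by exact_mod_cast hu1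
      have hv2 : (0 : ℝ) < v := by exact_mod_cast hv1
      refine le_trans ?_ (neg_le_abs _)
      nlinarith
  have hone : (1 : ℝ) ≤ |(cfQ x k * p - cfP x k * q : ℝ)| := by
    have : (cfQ x k * p - cfP x k * q : ℤ) ≠ 0 := fun h0 => hv0 (by rw [hv, h0, mul_zero])
    exact_mod_cast Int.one_le_abs this
  have hsplit : (cfQ x k * p - cfP x k * q : ℝ) = q * cfErr x k - cfQ x k * (q * x - p) := by
    rw [cfErr]
    ring
  have hqk' : (cfQ x k : ℝ) ≤ q := by exact_mod_cast hk
  have htri := abs_sub (q * cfErr x k) (cfQ x k * (q * x - p))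
  rw [← hsplit, abs_mul, abs_mul, Nat.abs_cast, Nat.abs_cast] at htri
  nlinarith [mul_le_mul_of_nonneg_left hmain (Nat.cast_nonneg (α := ℝ) q),
    mul_le_mul_of_nonneg_right hqk' (abs_nonneg (q * x - p))]

end ContinuedFraction

lemma le_four_mul_mlog_cfQ {x : ℝ} (hx : Irrational x) (k : ℕ) : (k : ℝ) ≤ 4 * mlog (cfQ x k) := by
  have h1 : ((k / 2 : ℕ) : ℝ) * Real.log 2 ≤ mlog (cfQ x k) := by
    rw [← Real.log_pow]
    refine (log_le_mlog (by positivity)).trans (mlog_mono ?_)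
    exact_mod_cast two_pow_le_cfQ hx k
  have h2 : (k : ℝ) ≤ 2 * (k / 2 : ℕ) + 1 := by
    exact_mod_cast (by omega : k ≤ 2 * (k / 2) + 1)
  have h3 := one_le_mlog (cfQ x k)
  have h4 : (0 : ℝ) ≤ (k / 2 : ℕ) := Nat.cast_nonneg _
  nlinarith [Real.log_two_gt_d9]

lemma mul_mlog_le_of_le {k y : ℝ} (hk : 0 ≤ k) (h : k ≤ 4 * y) :
    k * mlog k * mlog (mlog k) ≤ 36 * (y * mlog y * mlog (mlog y)) := by
  have h1 : mlog k ≤ 3 * mlog y :=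
    (mlog_mono h).trans (mlog_mul_le_three_mul y (by norm_num) le_rfl)
  have h2 : mlog (mlog k) ≤ 3 * mlog (mlog y) :=
    (mlog_mono h1).trans (mlog_mul_le_three_mul _ (by norm_num) (by norm_num))
  have := mlog_pos k
  have := mlog_pos y
  have := mlog_pos (mlog k)
  have : 0 ≤ y := by linarith
  calc k * mlog k * mlog (mlog k) ≤ (4 * y) * (3 * mlog y) * (3 * mlog (mlog y)) := by gcongr
    _ = _ := by ring

/-- A reduced fraction approximating `x` from below to within `ψ(q) / (2 q)` is an even
convergent which is followed by a large partial quotient. -/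
lemma exists_even_convergent_of_sub_le {x : ℝ} (hx : Irrational x) (hx0 : 0 ≤ x) (hx1 : x < 1)
    {q : ℕ} (hq : 0 < q) {p : ℤ} (hpq : IsCoprime p (q : ℤ)) (h0 : 0 ≤ x - p / q)
    (h : x - p / q ≤ psiDS q / (2 * q)) :
    ∃ k, Even k ∧ cfQ x k = q ∧ (cfP x k : ℤ) = p ∧
      1 / 108 * k * mlog k * mlog (mlog k) ≤ (cfA x (k + 1) : ℝ) := by
  have hq0 : (0 : ℝ) < q := by exact_mod_cast hq
  have hmul : q * (x - p / q) = q * x - p := by field_simp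
  have hE0 : 0 ≤ q * x - p := by rw [← hmul]; positivity
  have hE1 : q * x - p ≤ psiDS q / 2 := by
    calc q * x - p ≤ q * (psiDS q / (2 * q)) := by rw [← hmul]; gcongr
      _ = _ := by field_simp
  have hirr : Irrational (q * x - p) := (hx.natCast_mul hq.ne').sub_intCast p
  have hlt : q * |q * x - p| < 1 / 2 := by
    have hle : q * (q * x - p) ≤ 1 / 2 := by
      calc q * (q * x - p) ≤ q * ((1 / q) / 2) := by
            gcongr
            exact hE1.trans (by gcongr; exact psiDS_le q)
        _ = _ := by field_simp
    rw [abs_of_nonneg hE0]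
    refine hle.lt_of_ne fun heq => ?_
    exact (hirr.natCast_mul hq.ne').ne_rat (1 / 2) (by rw [heq]; norm_num)
  obtain ⟨k, rfl, rfl⟩ := exists_cf_eq_of_abs_lt hx hx0 hx1 hq hpq hlt
  rw [Int.cast_natCast] at hE0 hE1
  change 0 ≤ cfErr x k at hE0
  change cfErr x k ≤ _ at hE1
  have heven : Even k := by
    by_contra hodd
    have := neg_one_pow_mul_cfErr_pos hx hx0 hx1 k
    rw [(Nat.not_even_iff_odd.mp hodd).neg_one_pow] at this
    linarith
  refine ⟨k, heven, rfl, rfl, ?_⟩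
  have hbig := one_le_cfErr_mul_cfA hx hx0 hx1 heven
  have hL := mul_mlog_le_of_le (Nat.cast_nonneg k) (le_four_mul_mlog_cfQ hx k)
  set y := mlog (cfQ x k) with hy
  have hy0 : 0 < y := mlog_pos _
  have hy1 := mlog_pos y
  have hy2 := mlog_pos (mlog y)
  have ha : y * mlog y * mlog (mlog y) ≤ 3 * cfA x (k + 1) := by
    have h1 : 1 ≤ psiDS (cfQ x k) * (3 * cfA x (k + 1) * cfQ x k) := by
      refine hbig.trans ?_
      gcongr
      linarith [psiDS_nonneg (cfQ x k)]
    have h2 : psiDS (cfQ x k) * (3 * cfA x (k + 1) * cfQ x k)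
        = 3 * cfA x (k + 1) / (y * mlog y * mlog (mlog y)) := by
      rw [psiDS, ← hy]
      field_simp
    rwa [h2, one_le_div (by positivity)] at h1
  linarith

lemma ae_irrational_iota : ∀ᵐ x : UnitAddCircle, Irrational (iota x) := by
  have : NullSingletonClass (volume : Measure UnitAddCircle) :=
    ⟨fun x => by rw [← Metric.closedBall_zero, AddCircle.volume_closedBall]; simp⟩
  have hc : (range fun r : ℚ => ((r : ℝ) : UnitAddCircle)).Countable := countable_range _
  filter_upwards [measure_eq_zero_iff_ae_notMem.mp (hc.measure_zero volume)] with x hx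
  rintro ⟨r, hr⟩
  exact hx ⟨r, by
    change ((r : ℝ) : UnitAddCircle) = x
    rw [hr]
    exact (AddCircle.equivIco 1 0).symm_apply_apply x⟩

/-- For `A ⊆ ℕ` of positive lower density, for a.e. `α ∈ 𝕋` there are a constant
`C > 0` and infinitely many even indices `k` with `q_k ∈ A`,
`0 ≤ α - p_k/q_k < ψ(q_k)/q_k` and `a_{k+1} ≥ C k log k log log k`. -/
theorem exists_infinitely_many_good_even_convergents (A : Set ℕ) (hA : 0 < lowerDensity A) :
    ∀ᵐ α ∂(volume : Measure UnitAddCircle), ∃ C : ℝ, 0 < C ∧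
      {k : ℕ | Even k ∧ cfQ (iota α) k ∈ A ∧
        0 ≤ iota α - (cfP (iota α) k : ℝ) / (cfQ (iota α) k : ℝ) ∧
        iota α - (cfP (iota α) k : ℝ) / (cfQ (iota α) k : ℝ)
          < psiDS (cfQ (iota α) k) / (cfQ (iota α) k : ℝ) ∧
        C * k * mlog k * mlog (mlog k) ≤ (cfA (iota α) (k + 1) : ℝ)}.Infinite := by
  obtain ⟨c, hc, ρ, hρ, K, hK⟩ := exists_count_totient_ge_of_lowerDensity_pos hA
  set B : Set ℕ := {n | n ∈ A ∧ c * n ≤ n.totient}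
  have hns : ¬ Summable (B.indicator psiDS) := not_summable_indicator_of_count psiDS_nonneg
    (fun _ _ hm hmn => psiDS_anti hm hmn) not_summable_psiDS hρ
    fun N => by convert hK N
  have hae := ae_frequently_coprime_one_sided (f := B.indicator psiDS)
    (fun n => indicator_nonneg (fun m _ => psiDS_nonneg m) n) hns
    (fun n => (indicator_le_self' (fun _ _ => psiDS_nonneg _) n).trans (psiDS_le n)) hc
    (fun n hn => (mem_of_indicator_ne_zero hn).2)
  filter_upwards [hae, ae_irrational_iota] with α hα hirr
  have hmem : iota α ∈ Ico (0 : ℝ) (0 + 1) := (AddCircle.equivIco 1 0 α).2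
  rw [zero_add] at hmem
  refine ⟨1 / 108, by norm_num, Infinite.of_image (cfQ (iota α)) ?_⟩
  refine (Nat.frequently_atTop_iff_infinite.mp (hα.and_eventually (eventually_gt_atTop 0))).mono ?_
  rintro n ⟨⟨hn, p, hp, h0, h⟩, hn0⟩
  have hnB : n ∈ B := mem_of_indicator_ne_zero hn.ne'
  rw [indicator_of_mem hnB] at hn h
  obtain ⟨k, hk, rfl, rfl, ha⟩ := exists_even_convergent_of_sub_le hirr hmem.1 hmem.2 hn0 hp h0 h
  rw [Int.cast_natCast] at h0 h
  have hq : (0 : ℝ) < cfQ (iota α) k := by exact_mod_cast hn0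
  refine ⟨k, ⟨hk, hnB.1, h0, h.trans_lt ?_, ha⟩, rfl⟩
  gcongr
  linarith
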